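/- Let G = GL₂(F₁₃) and let π : G → PGL₂(F₁₃) be the quotient map by the center. Let B ≤ G be the subgroup of upper triangular matrices (the Borel subgroup) and let N ≤ G be the subgroup consisting of the diagonal and antidiagonal matrices (the normaliser of the split Cartan subgroup). Let u and t be the images under π of the matrices [[1,1],[0,1]] and [[2,0],[0,1]] respectively, and set K₂ = ⟨u, t⁶⟩ (a dihedral group of order 26), K₃ = ⟨u, t⁴⟩ (a group of order 39, isomorphic to C₁₃ ⋊ C₃), K₄ = ⟨u, t³⟩ (a group of order 52, isomorphic to C₁₃ ⋊ C₄), and let K₁ be any subgroup of PGL₂(F₁₃) isomorphic to S₄. Then there is an isomorphism of ℚ-linear representations of G (equivalently, of modules over the group algebra ℚ[G]): ℚ[G/N] ⊕ ℚ[G/N] ⊕ ℚ[G/π⁻¹(K₃)] ⊕ ℚ[G/π⁻¹(K₄)] ≅ ℚ[G/π⁻¹(K₁)] ⊕ ℚ[G/π⁻¹(K₁)] ⊕ ℚ[G/π⁻¹(K₂)] ⊕ ℚ[G/B], where for a subgroup H ≤ G, ℚ[G/H] denotes the permutation representation of G on the ℚ-vector space with basis the left coset space G/H. -/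

import Mathlib

open Matrix

set_option synthInstance.maxHeartbeats 1000000
set_option maxHeartbeats 1000000

instance : Fact (Nat.Prime 13) := ⟨by norm_num⟩

/-- `G = GL₂(F₁₃)`. -/
abbrev GL2F13 := GL (Fin 2) (ZMod 13)

/-- `PGL₂(F₁₃)`: the quotient of `GL₂(F₁₃)` by its center (the scalar matrices). -/
abbrev PGL2F13 := GL2F13 ⧸ Subgroup.center GL2F13

/-- The quotient map `π : GL₂(F₁₃) → PGL₂(F₁₃)`. -/
noncomputable def projGL : GL2F13 →* PGL2F13 := QuotientGroup.mk' _

/-- The Borel subgroup `B` of `GL₂(F₁₃)`: the subgroup of upper triangular matrices. -/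
def borelSubgroup : Subgroup GL2F13 where
  carrier := {g | (g : Matrix (Fin 2) (Fin 2) (ZMod 13)) 1 0 = 0}
  one_mem' := by simp [Matrix.one_apply]
  mul_mem' := by
    intro a b ha hb
    simp only [Set.mem_setOf_eq] at ha hb ⊢
    simp [Units.val_mul, Matrix.mul_apply, Fin.sum_univ_two, ha, hb]
  inv_mem' := by
    intro a ha
    simp only [Set.mem_setOf_eq] at ha ⊢
    simp [Matrix.coe_units_inv, Matrix.inv_def, Matrix.adjugate_fin_two, ha]

/-- The normaliser `N` of the split Cartan subgroup of `GL₂(F₁₃)`: the subgroup consisting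
of the diagonal and the antidiagonal matrices. -/
def splitCartanNormalizer : Subgroup GL2F13 where
  carrier := {g | ((g : Matrix (Fin 2) (Fin 2) (ZMod 13)) 0 1 = 0 ∧
      (g : Matrix (Fin 2) (Fin 2) (ZMod 13)) 1 0 = 0)
    ∨ ((g : Matrix (Fin 2) (Fin 2) (ZMod 13)) 0 0 = 0 ∧
      (g : Matrix (Fin 2) (Fin 2) (ZMod 13)) 1 1 = 0)}
  one_mem' := by
    left; constructor <;> simp [Matrix.one_apply]
  mul_mem' := by
    rintro a b (⟨ha1, ha2⟩ | ⟨ha1, ha2⟩) (⟨hb1, hb2⟩ | ⟨hb1, hb2⟩)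
    · left
      constructor <;>
        simp [Units.val_mul, Matrix.mul_apply, Fin.sum_univ_two, ha1, ha2, hb1, hb2]
    · right
      constructor <;>
        simp [Units.val_mul, Matrix.mul_apply, Fin.sum_univ_two, ha1, ha2, hb1, hb2]
    · right
      constructor <;>
        simp [Units.val_mul, Matrix.mul_apply, Fin.sum_univ_two, ha1, ha2, hb1, hb2]
    · left
      constructor <;>
        simp [Units.val_mul, Matrix.mul_apply, Fin.sum_univ_two, ha1, ha2, hb1, hb2]
  inv_mem' := by
    rintro a (⟨h1, h2⟩ | ⟨h1, h2⟩)
    · left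
      constructor <;>
        simp [Matrix.coe_units_inv, Matrix.inv_def, Matrix.adjugate_fin_two, h1, h2]
    · right
      constructor <;>
        simp [Matrix.coe_units_inv, Matrix.inv_def, Matrix.adjugate_fin_two, h1, h2]

/-- The image `u` in `PGL₂(F₁₃)` of the matrix `[[1, 1], [0, 1]]`. -/
noncomputable def uElt : PGL2F13 :=
  projGL (Matrix.GeneralLinearGroup.mkOfDetNeZero !![(1 : ZMod 13), 1; 0, 1] (by decide))

/-- The image `t` in `PGL₂(F₁₃)` of the matrix `[[2, 0], [0, 1]]`. -/
noncomputable def tElt : PGL2F13 :=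
  projGL (Matrix.GeneralLinearGroup.mkOfDetNeZero !![(2 : ZMod 13), 0; 0, 1] (by decide))

/-- `K₂ = ⟨u, t⁶⟩ ≤ PGL₂(F₁₃)` (a dihedral group of order 26). -/
noncomputable def K2 : Subgroup PGL2F13 := Subgroup.closure {uElt, tElt ^ 6}

/-- `K₃ = ⟨u, t⁴⟩ ≤ PGL₂(F₁₃)` (a group of order 39, isomorphic to `C₁₃ ⋊ C₃`). -/
noncomputable def K3 : Subgroup PGL2F13 := Subgroup.closure {uElt, tElt ^ 4}

/-- `K₄ = ⟨u, t³⟩ ≤ PGL₂(F₁₃)` (a group of order 52, isomorphic to `C₁₃ ⋊ C₄`). -/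
noncomputable def K4 : Subgroup PGL2F13 := Subgroup.closure {uElt, tElt ^ 3}

attribute [local instance] Finsupp.comapSMul Finsupp.comapMulAction Finsupp.comapDistribMulAction

/-- The permutation module `ℚ[G/H]`: the `ℚ`-vector space with basis the left coset space
`G/H`, on which `G = GL₂(F₁₃)` acts by left translation. -/
abbrev permModule (H : Subgroup GL2F13) := (GL2F13 ⧸ H) →₀ ℚ

namespace Representation

variable {G k : Type*} [Group G] [Field k]

theorem char_prod {V W : Type*} [AddCommGroup V] [Module k V]
    [AddCommGroup W] [Module k W] [FiniteDimensional k V] [FiniteDimensional k W]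
    (ρ : Representation k G V) (σ : Representation k G W) :
    (ρ.prod σ).character = ρ.character + σ.character := by
  ext g
  exact LinearMap.trace_prodMap' (ρ g) (σ g)

/-- A representation is the direct product of two complementary subrepresentations. -/
noncomputable def prodEquivOfIsCompl {V : Type*} [AddCommGroup V] [Module k V]
    {ρ : Representation k G V} (P Q : Subrepresentation ρ)
    (h : IsCompl P.toSubmodule Q.toSubmodule) :
    Equiv (P.toRepresentation.prod Q.toRepresentation) ρ :=
  Equiv.mk (Submodule.prodEquivOfIsCompl _ _ h) fun g => by
    ext x <;> simp [Subrepresentation.toRepresentation]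

theorem _root_.Subrepresentation.exists_isCompl_toSubmodule [Finite G] [CharZero k]
    {V : Type*} [AddCommGroup V] [Module k V]
    {ρ : Representation k G V} (P : Subrepresentation ρ) :
    ∃ Q : Subrepresentation ρ, IsCompl P.toSubmodule Q.toSubmodule := by
  have : NeZero (Nat.card G : k) := ⟨Nat.cast_ne_zero.2 Nat.card_pos.ne'⟩
  obtain ⟨Q, hQ⟩ := ComplementedLattice.exists_isCompl P
  refine ⟨Q, ?_, ?_⟩
  · rw [disjoint_iff, ← Subrepresentation.toSubmodule_inf, hQ.inf_eq_bot]; rfl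
  · rw [codisjoint_iff, ← Subrepresentation.toSubmodule_sup, hQ.sup_eq_top]; rfl

theorem exists_intertwiningMap_ne_zero_of_character_eq [Finite G] [CharZero k]
    {V W : Type*} [AddCommGroup V] [Module k V] [FiniteDimensional k V] [Nontrivial V]
    [AddCommGroup W] [Module k W] [FiniteDimensional k W]
    {ρ : Representation k G V} {σ : Representation k G W} (h : ρ.character = σ.character) :
    ∃ f : IntertwiningMap ρ σ, f ≠ 0 := by
  have := Fintype.ofFinite G
  have := invertibleOfNonzero (Nat.cast_ne_zero.2 Nat.card_pos.ne' : (Nat.card G : k) ≠ 0)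
  have h1 := card_inv_mul_sum_char_mul_char_eq_finrank ρ σ
  rw [← h, card_inv_mul_sum_char_mul_char_eq_finrank ρ ρ, Nat.cast_inj] at h1
  by_contra! h0
  have : Subsingleton (IntertwiningMap ρ σ) := ⟨fun a b => by rw [h0 a, h0 b]⟩
  rw [Module.finrank_zero_of_subsingleton (M := IntertwiningMap ρ σ)] at h1
  have : FiniteDimensional k (IntertwiningMap ρ ρ) :=
    Module.Finite.equiv (invariantsEquivIntertwiningMap ρ ρ)
  have := Module.finrank_zero_iff.1 h1
  obtain ⟨v, hv⟩ := exists_ne (0 : V)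
  exact hv congr($(Subsingleton.elim (IntertwiningMap.id ρ) 0) v)

theorem nonempty_equiv_of_character_eq [Finite G] [CharZero k]
    {V W : Type*} [AddCommGroup V] [Module k V] [FiniteDimensional k V]
    [AddCommGroup W] [Module k W] [FiniteDimensional k W]
    {ρ : Representation k G V} {σ : Representation k G W} (h : ρ.character = σ.character) :
    Nonempty (Equiv ρ σ) := by
  induction hn : Module.finrank k V using Nat.strong_induction_on generalizing V W with
  | _ n ih =>
  have hVW : Module.finrank k V = Module.finrank k W := by
    have := congr_fun h 1
    rwa [char_one, char_one, Nat.cast_inj] at this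
  rcases subsingleton_or_nontrivial V with hV | hV
  · have : Subsingleton W := by
      rw [Module.finrank_zero_of_subsingleton] at hVW
      exact Module.finrank_zero_iff.1 hVW.symm
    exact ⟨Equiv.mk (LinearEquiv.ofFinrankEq V W hVW) fun g =>
      LinearMap.ext fun _ => Subsingleton.elim _ _⟩
  · obtain ⟨f, hf⟩ := exists_intertwiningMap_ne_zero_of_character_eq h
    obtain ⟨Q, hQ⟩ := f.ker.exists_isCompl_toSubmodule
    obtain ⟨S, hS⟩ := f.range.exists_isCompl_toSubmodule
    have e₁ : Equiv Q.toRepresentation f.range.toRepresentation := by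
      have hb : Function.Bijective
          ((f.toLinearMap.rangeRestrict ∘ₗ Q.toSubmodule.subtype :
            Q.toSubmodule →ₗ[k] LinearMap.range f.toLinearMap)) := by
        constructor
        · rw [← LinearMap.ker_eq_bot, LinearMap.ker_eq_bot']
          intro x hx
          have hx' : (x : V) ∈ f.ker.toSubmodule := congr_arg Subtype.val hx
          exact Subtype.ext (Submodule.disjoint_def.1 hQ.disjoint x hx' x.2)
        · rintro ⟨_, v, rfl⟩
          obtain ⟨p, hp, q, hq, rfl⟩ := Submodule.mem_sup.1
            (hQ.sup_eq_top.symm ▸ Submodule.mem_top : v ∈ f.ker.toSubmodule ⊔ Q.toSubmodule)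
          refine ⟨⟨q, hq⟩, Subtype.ext ?_⟩
          have hp' : f p = 0 := hp
          simp [hp']
      exact Equiv.mk (LinearEquiv.ofBijective _ hb) fun g => by
        ext x
        exact f.isIntertwining _ _ g x
    have hPQ := char_iso (prodEquivOfIsCompl _ _ hQ)
    have hRS := char_iso (prodEquivOfIsCompl _ _ hS)
    rw [char_prod] at hPQ hRS
    obtain ⟨e₂⟩ := ih (Module.finrank k f.ker.toSubmodule) (by
        rw [← hn]
        refine Submodule.finrank_lt fun htop => hf ?_
        ext v
        exact (htop.symm ▸ Submodule.mem_top : v ∈ f.ker.toSubmodule))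
      (ρ := f.ker.toRepresentation) (σ := S.toRepresentation) (by
        rw [← hPQ, ← hRS, char_iso e₁, add_comm] at h
        exact add_left_cancel h) rfl
    refine ⟨(prodEquivOfIsCompl _ _ hQ).symm.trans (Equiv.trans ?_ (prodEquivOfIsCompl _ _ hS))⟩
    refine Equiv.mk ((LinearEquiv.prodComm k _ _).trans
      (e₁.toLinearEquiv.prodCongr e₂.toLinearEquiv)) fun g => ?_
    refine LinearMap.ext fun x => Prod.ext ?_ ?_
    · exact e₁.toIntertwiningMap.isIntertwining _ _ g x.2
    · exact e₂.toIntertwiningMap.isIntertwining _ _ g x.1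

end Representation

section Counting

variable {G : Type*} [Group G]

theorem trace_lmapDomain_smul {X : Type*} [MulAction G X] [Finite X] (g : G) :
    LinearMap.trace ℚ (X →₀ ℚ) (Finsupp.lmapDomain ℚ ℚ (g • · : X → X)) =
      Nat.card {x : X // g • x = x} := by
  classical
  have := Fintype.ofFinite X
  rw [LinearMap.trace_eq_matrix_trace ℚ Finsupp.basisSingleOne, Matrix.trace]
  simp [LinearMap.toMatrix_apply, Finsupp.single_apply, Fintype.card_subtype]

theorem card_fixed_quotient_mul_card (H : Subgroup G) (g : G) :
    Nat.card {x : G ⧸ H // g • x = x} * Nat.card H = Nat.card {a : G // a⁻¹ * g * a ∈ H} := by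
  rw [mul_comm, ← Nat.card_prod]
  refine Nat.card_congr (((QuotientGroup.preimageMkEquivSubgroupProdSet H
    {x : G ⧸ H | g • x = x}).symm).trans (Equiv.subtypeEquivRight fun a => ?_))
  change ((g * a : G) : G ⧸ H) = a ↔ _
  rw [eq_comm, QuotientGroup.eq, mul_assoc]

theorem card_conj_mem [Finite G] (H : Subgroup G) (g : G) :
    Nat.card {a : G // a⁻¹ * g * a ∈ H} =
      Nat.card {h : G // h ∈ H ∧ IsConj g h} * Nat.card {a : G // a⁻¹ * g * a = g} := by
  rw [← Nat.card_prod]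
  have key (h : {h : G // h ∈ H ∧ IsConj g h}) : ∃ b : G, b * g * b⁻¹ = h :=
    isConj_iff.1 h.2.2
  choose b hb using key
  let f (p : {a : G // a⁻¹ * g * a ∈ H}) : {h : G // h ∈ H ∧ IsConj g h} :=
    ⟨p.1⁻¹ * g * p.1, p.2, isConj_iff.2 ⟨p.1⁻¹, by simp⟩⟩
  have hf (q : {h : G // h ∈ H ∧ IsConj g h} × {a : G // a⁻¹ * g * a = g}) :
      (q.2.1 * (b q.1)⁻¹)⁻¹ * g * (q.2.1 * (b q.1)⁻¹) = q.1 := by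
    calc _ = b q.1 * (q.2.1⁻¹ * g * q.2.1) * (b q.1)⁻¹ := by group
      _ = _ := by rw [q.2.2, hb]
  refine Nat.card_congr ⟨fun p => (f p, ⟨p.1 * b (f p), ?_⟩),
    fun q => ⟨q.2.1 * (b q.1)⁻¹, by rw [hf]; exact q.1.2.1⟩, fun p => ?_, fun q => ?_⟩
  · calc _ = (b (f p))⁻¹ * (p.1⁻¹ * g * p.1) * b (f p) := by group
      _ = (b (f p))⁻¹ * (f p : G) * b (f p) := rfl
      _ = g := by rw [← hb]; group
  · simp
  · have hq : f ⟨q.2.1 * (b q.1)⁻¹, by rw [hf]; exact q.1.2.1⟩ = q.1 := Subtype.ext (hf q)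
    refine Prod.ext hq (Subtype.ext ?_)
    simp [hq]

theorem card_fixed_quotient [Finite G] (H : Subgroup G) (g : G) :
    Nat.card {x : G ⧸ H // g • x = x} * Nat.card H =
      Nat.card {h : G // h ∈ H ∧ IsConj g h} * Nat.card {a : G // a⁻¹ * g * a = g} := by
  rw [card_fixed_quotient_mul_card, card_conj_mem]

end Counting

section Conjugacy

variable {F : Type*} [Field F]

theorem mem_center_iff_entries (g : GL (Fin 2) F) :
    g ∈ Subgroup.center (GL (Fin 2) F) ↔
      g.val 0 1 = 0 ∧ g.val 1 0 = 0 ∧ g.val 0 0 = g.val 1 1 := by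
  rw [GeneralLinearGroup.center_eq_range_scalar, MonoidHom.mem_range]
  constructor
  · rintro ⟨r, rfl⟩
    simp
  · rintro ⟨h1, h2, h3⟩
    have h0 : g.val 0 0 ≠ 0 := by
      intro h
      have := g.det_ne_zero
      rw [Matrix.det_fin_two] at this
      simp [h, h1] at this
    refine ⟨Units.mk0 _ h0, ?_⟩
    ext i j
    fin_cases i <;> fin_cases j <;> simp [h1, h2, h3]

/-- The companion matrix of `X ^ 2 - t X + d`. -/
def companionGL (t : F) (d : F) (hd : d ≠ 0) : GL (Fin 2) F :=
  GeneralLinearGroup.mkOfDetNeZero !![0, -d; 1, t] (by simpa using hd)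

theorem isConj_companionGL (g : GL (Fin 2) F) (hg : g ∉ Subgroup.center (GL (Fin 2) F)) :
    IsConj (companionGL g.val.trace g.val.det g.det_ne_zero) g := by
  have key (x y : F) (h : x * (g.val 1 0 * x + g.val 1 1 * y)
      - y * (g.val 0 0 * x + g.val 0 1 * y) ≠ 0) :
      IsConj (companionGL g.val.trace g.val.det g.det_ne_zero) g := by
    have hP : (!![x, g.val 0 0 * x + g.val 0 1 * y;
        y, g.val 1 0 * x + g.val 1 1 * y] : Matrix (Fin 2) (Fin 2) F).det ≠ 0 := by
      rw [Matrix.det_fin_two_of]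
      convert h using 1
      ring
    refine isConj_iff.2 ⟨GeneralLinearGroup.mkOfDetNeZero _ hP, mul_inv_eq_iff_eq_mul.2 ?_⟩
    ext i j
    fin_cases i <;> fin_cases j <;>
      simp [companionGL, GeneralLinearGroup.mkOfDetNeZero, Matrix.mul_apply, Fin.sum_univ_two,
        Matrix.trace_fin_two, Matrix.det_fin_two] <;> ring
  by_cases h10 : g.val 1 0 = 0
  · by_cases h01 : g.val 0 1 = 0
    · refine key 1 1 fun h => hg ((mem_center_iff_entries g).2 ⟨h01, h10, ?_⟩)
      simp [h10, h01] at h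
      linear_combination -h
    · exact key 0 1 (by simpa using h01)
  · exact key 1 0 (by simpa using h10)

theorem isConj_iff_trace_det {g : GL (Fin 2) F} (hg : g ∉ Subgroup.center (GL (Fin 2) F))
    (h : GL (Fin 2) F) :
    IsConj g h ↔ h ∉ Subgroup.center (GL (Fin 2) F) ∧
      h.val.trace = g.val.trace ∧ h.val.det = g.val.det := by
  constructor
  · intro hc
    obtain ⟨c, rfl⟩ := isConj_iff.1 hc
    refine ⟨fun hz => hg ?_, ?_, ?_⟩
    · have := Subgroup.Normal.conj_mem inferInstance _ hz c⁻¹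
      simpa [mul_assoc] using this
    · rw [Units.val_mul, Matrix.trace_mul_comm, ← Units.val_mul]
      simp
    · rw [Units.val_mul, Matrix.det_mul_comm, ← Units.val_mul]
      simp
  · rintro ⟨hh, ht, hd⟩
    have h1 := isConj_companionGL g hg
    have h2 := isConj_companionGL h hh
    simp only [ht, hd] at h2
    exact h1.symm.trans h2

theorem isConj_iff_eq_of_mem_center {G : Type*} [Group G] {g : G} (hg : g ∈ Subgroup.center G)
    (h : G) : IsConj g h ↔ h = g := by
  constructor
  · intro hc
    obtain ⟨c, rfl⟩ := isConj_iff.1 hc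
    rw [Subgroup.mem_center_iff.1 hg c, mul_inv_cancel_right]
  · rintro rfl
    exact IsConj.refl _

end Conjugacy

section UpperTriangular

/-- The upper triangular matrices in `GL₂(F₁₃)` whose diagonal entries have equal `m`-th powers. -/
def upperSubgroup (m : ℕ) : Subgroup GL2F13 where
  carrier := {g | g.val 1 0 = 0 ∧ g.val 0 0 ^ m = g.val 1 1 ^ m}
  one_mem' := by simp
  mul_mem' := by
    rintro a b ⟨ha, ha'⟩ ⟨hb, hb'⟩
    simp [Matrix.mul_apply, Fin.sum_univ_two, ha, hb, mul_pow, ha', hb']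
  inv_mem' := by
    rintro a ⟨ha, ha'⟩
    simp [Matrix.coe_units_inv, Matrix.inv_def, Matrix.adjugate_fin_two, ha, ha', mul_pow]

theorem mem_upperSubgroup {m : ℕ} {g : GL2F13} :
    g ∈ upperSubgroup m ↔ g.val 1 0 = 0 ∧ g.val 0 0 ^ m = g.val 1 1 ^ m := Iff.rfl

theorem center_le_upperSubgroup (m : ℕ) : Subgroup.center GL2F13 ≤ upperSubgroup m := by
  intro g hg
  obtain ⟨-, h1, h2⟩ := (mem_center_iff_entries g).1 hg
  exact ⟨h1, by rw [h2]⟩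

theorem diag_ne_zero_of_upper {g : GL2F13} (hg : g.val 1 0 = 0) :
    g.val 0 0 ≠ 0 ∧ g.val 1 1 ≠ 0 := by
  have := g.det_ne_zero
  rw [Matrix.det_fin_two, hg, mul_zero, sub_zero] at this
  exact mul_ne_zero_iff.1 this

theorem borelSubgroup_eq : borelSubgroup = upperSubgroup 12 := by
  ext g
  refine ⟨fun h => ⟨h, ?_⟩, fun h => h.1⟩
  obtain ⟨h1, h2⟩ := diag_ne_zero_of_upper h
  exact (ZMod.pow_card_sub_one_eq_one h1).trans (ZMod.pow_card_sub_one_eq_one h2).symm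

theorem projGL_eq_of_smul {g h : GL2F13} (r : ZMod 13) (hgh : g.val = r • h.val) :
    projGL g = projGL h := by
  refine QuotientGroup.eq.2 ((Subgroup.center GL2F13).inv_mem_iff.1 ?_)
  have hz : ∃ z ∈ Subgroup.center GL2F13, g = z * h := by
    have hr : r ≠ 0 := by
      rintro rfl
      exact g.det_ne_zero (by simp [hgh])
    refine ⟨GeneralLinearGroup.scalar (Fin 2) (Units.mk0 r hr), ?_, ?_⟩
    · rw [GeneralLinearGroup.center_eq_range_scalar]
      exact ⟨_, rfl⟩
    · ext i j
      simp [hgh]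
  obtain ⟨z, hz, rfl⟩ := hz
  simpa [mul_assoc, _root_.mul_inv_rev] using Subgroup.Normal.conj_mem inferInstance z hz h⁻¹

/-- The matrix `[[a, b], [0, 1]]`. -/
def affineGL (a b : ZMod 13) (ha : a ≠ 0) : GL2F13 :=
  GeneralLinearGroup.mkOfDetNeZero !![a, b; 0, 1] (by simpa using ha)

theorem uElt_pow (n : ℕ) : uElt ^ n = projGL (affineGL 1 n one_ne_zero) := by
  induction n with
  | zero =>
    rw [pow_zero, ← map_one projGL]
    congr 1
    ext i j
    fin_cases i <;> fin_cases j <;> simp [affineGL, GeneralLinearGroup.mkOfDetNeZero]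
  | succ n ih =>
    rw [pow_succ, ih, uElt, ← map_mul]
    congr 1
    ext i j
    fin_cases i <;> fin_cases j <;>
      simp [affineGL, GeneralLinearGroup.mkOfDetNeZero, Matrix.mul_apply, Fin.sum_univ_two,
        add_comm]

theorem tElt_pow (n : ℕ) :
    tElt ^ n = projGL (affineGL (2 ^ n) 0 (pow_ne_zero n (by decide))) := by
  induction n with
  | zero =>
    rw [pow_zero, ← map_one projGL]
    congr 1
    ext i j
    fin_cases i <;> fin_cases j <;> simp [affineGL, GeneralLinearGroup.mkOfDetNeZero]
  | succ n ih =>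
    rw [pow_succ, ih, tElt, ← map_mul]
    congr 1
    ext i j
    fin_cases i <;> fin_cases j <;>
      simp [affineGL, GeneralLinearGroup.mkOfDetNeZero, Matrix.mul_apply, Fin.sum_univ_two,
        pow_succ]

theorem comap_closure_eq {k m : ℕ} (hkm : k * m = 12)
    (hlog : ∀ a d : ZMod 13, a ≠ 0 → d ≠ 0 → a ^ m = d ^ m → ∃ i < 13, a = d * (2 ^ k) ^ i) :
    Subgroup.comap projGL (Subgroup.closure {uElt, tElt ^ k}) = upperSubgroup m := by
  apply le_antisymm
  · have hker : projGL.ker ≤ upperSubgroup m := by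
      rw [projGL, QuotientGroup.ker_mk']
      exact center_le_upperSubgroup m
    rw [← Subgroup.comap_map_eq_self hker]
    refine Subgroup.comap_mono ((Subgroup.closure_le _).2 ?_)
    rintro x (rfl | rfl)
    · exact ⟨_, by simp [mem_upperSubgroup, GeneralLinearGroup.mkOfDetNeZero], rfl⟩
    · rw [tElt_pow]
      refine ⟨_, ?_, rfl⟩
      have : (2 : ZMod 13) ^ 12 = 1 := by decide
      simp [mem_upperSubgroup, affineGL, GeneralLinearGroup.mkOfDetNeZero, ← pow_mul, hkm, this]
  · rintro g ⟨hg, hgm⟩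
    obtain ⟨ha, hd⟩ := diag_ne_zero_of_upper hg
    obtain ⟨i, -, hi⟩ := hlog _ _ ha hd hgm
    have : projGL g = uElt ^ (g.val 0 1 / g.val 1 1).val * (tElt ^ k) ^ i := by
      rw [← pow_mul, uElt_pow, tElt_pow, ← map_mul]
      refine projGL_eq_of_smul (g.val 1 1) ?_
      ext r s
      fin_cases r <;> fin_cases s <;>
        simp [affineGL, GeneralLinearGroup.mkOfDetNeZero, hg, hi, pow_mul]
      field_simp
    rw [Subgroup.mem_comap, this]
    exact mul_mem (pow_mem (Subgroup.subset_closure (by simp)) _)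
      (pow_mem (Subgroup.subset_closure (by simp)) _)

theorem comap_K2 : Subgroup.comap projGL K2 = upperSubgroup 2 :=
  comap_closure_eq (k := 6) (by norm_num) (by decide +kernel)

theorem comap_K3 : Subgroup.comap projGL K3 = upperSubgroup 3 :=
  comap_closure_eq (k := 4) (by norm_num) (by decide +kernel)

theorem comap_K4 : Subgroup.comap projGL K4 = upperSubgroup 4 :=
  comap_closure_eq (k := 3) (by norm_num) (by decide +kernel)

/-- A subgroup of `GL₂(F₁₃)` has this many non-central elements of trace `t` and determinant `d`. -/
noncomputable def classCount (H : Subgroup GL2F13) (t d : ZMod 13) : ℕ :=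
  Nat.card {h : GL2F13 // h ∈ H ∧ h ∉ Subgroup.center GL2F13 ∧ h.val.trace = t ∧ h.val.det = d}

theorem classCount_upperSubgroup (m : ℕ) {t d : ZMod 13} (hd : d ≠ 0) :
    classCount (upperSubgroup m) t d =
      ∑ a : ZMod 13, if a * (t - a) = d ∧ a ^ m = (t - a) ^ m then
        (if a = t - a then 12 else 13) else 0 := by
  have e : {h : GL2F13 // h ∈ upperSubgroup m ∧ h ∉ Subgroup.center GL2F13 ∧
        h.val.trace = t ∧ h.val.det = d} ≃
      (a : ZMod 13) × {b : ZMod 13 //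
        (a * (t - a) = d ∧ a ^ m = (t - a) ^ m) ∧ (a = t - a → b ≠ 0)} :=
    { toFun := fun h => ⟨h.1.val 0 0, h.1.val 0 1, by
        obtain ⟨h, ⟨h1, h2⟩, h3, rfl, rfl⟩ := h
        rw [mem_center_iff_entries] at h3
        simp only [Matrix.trace_fin_two, Matrix.det_fin_two, h1, add_sub_cancel_left]
        refine ⟨⟨by ring, h2⟩, fun h4 h5 => h3 ⟨h5, h1, h4⟩⟩⟩
      invFun := fun p => ⟨GeneralLinearGroup.mkOfDetNeZero !![p.1, p.2.1; 0, t - p.1] (by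
          simp [p.2.2.1.1, hd]), by
          obtain ⟨a, b, ⟨h1, h2⟩, h3⟩ := p
          simp [mem_center_iff_entries, mem_upperSubgroup, GeneralLinearGroup.mkOfDetNeZero,
            Matrix.trace_fin_two, h1, h2]
          grind⟩
      left_inv := by
        rintro ⟨h, ⟨h1, h2⟩, h3, rfl, rfl⟩
        refine Subtype.ext ?_
        ext i j
        fin_cases i <;> fin_cases j <;>
          simp [GeneralLinearGroup.mkOfDetNeZero, Matrix.trace_fin_two, h1]
      right_inv := by
        rintro ⟨a, b, h⟩
        exact Sigma.subtype_ext rfl rfl }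
  rw [classCount, Nat.card_congr e, Nat.card_sigma]
  refine Finset.sum_congr rfl fun a _ => ?_
  by_cases h1 : a * (t - a) = d ∧ a ^ m = (t - a) ^ m
  · by_cases h2 : a = t - a
    · rw [if_pos h1, if_pos h2]
      rw [Nat.card_congr (Equiv.subtypeEquivRight (q := (· ≠ 0)) fun b =>
        ⟨fun h => h.2 h2, fun h => ⟨h1, fun _ => h⟩⟩), Nat.card_eq_fintype_card]
      rfl
    · rw [if_pos h1, if_neg h2]
      simp [h1, h2]
  · simp [h1]

theorem card_upperSubgroup (m : ℕ) :
    Nat.card (upperSubgroup m) =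
      13 * Fintype.card {p : ZMod 13 × ZMod 13 // p.1 ≠ 0 ∧ p.2 ≠ 0 ∧ p.1 ^ m = p.2 ^ m} := by
  have e : upperSubgroup m ≃ ZMod 13 ×
      {p : ZMod 13 × ZMod 13 // p.1 ≠ 0 ∧ p.2 ≠ 0 ∧ p.1 ^ m = p.2 ^ m} :=
    { toFun := fun h => ⟨h.1.val 0 1, (h.1.val 0 0, h.1.val 1 1),
        (diag_ne_zero_of_upper h.2.1).1, (diag_ne_zero_of_upper h.2.1).2, h.2.2⟩
      invFun := fun p => ⟨GeneralLinearGroup.mkOfDetNeZero !![p.2.1.1, p.1; 0, p.2.1.2] (by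
          simp [p.2.2.1, p.2.2.2.1]), by
          simp [mem_upperSubgroup, GeneralLinearGroup.mkOfDetNeZero, p.2.2.2.2]⟩
      left_inv := by
        rintro ⟨h, h1, h2⟩
        refine Subtype.ext ?_
        ext i j
        fin_cases i <;> fin_cases j <;>
          simp [GeneralLinearGroup.mkOfDetNeZero, h1]
      right_inv := by
        rintro ⟨b, ⟨a, d⟩, h⟩
        simp [GeneralLinearGroup.mkOfDetNeZero] }
  rw [Nat.card_congr e, Nat.card_prod, Nat.card_zmod, Nat.card_eq_fintype_card]

end UpperTriangular

section SplitCartan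

theorem center_le_splitCartanNormalizer : Subgroup.center GL2F13 ≤ splitCartanNormalizer := by
  intro g hg
  obtain ⟨h0, h1, -⟩ := (mem_center_iff_entries g).1 hg
  exact Or.inl ⟨h0, h1⟩

/-- A matrix in the normaliser of the split Cartan subgroup is diagonal or antidiagonal. -/
def splitCartanNormalizerEquiv :
    splitCartanNormalizer ≃ Bool × {p : ZMod 13 × ZMod 13 // p.1 ≠ 0 ∧ p.2 ≠ 0} where
  toFun h := if hd : h.1.val 0 1 = 0 ∧ h.1.val 1 0 = 0
    then (true, ⟨(h.1.val 0 0, h.1.val 1 1), diag_ne_zero_of_upper hd.2⟩)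
    else (false, ⟨(h.1.val 0 1, h.1.val 1 0), by
      have h1 := h.2.resolve_left hd
      have := h.1.det_ne_zero
      rw [Matrix.det_fin_two, h1.1, zero_mul, zero_sub] at this
      exact mul_ne_zero_iff.1 (neg_ne_zero.1 this)⟩)
  invFun p := match p with
    | (true, p) => ⟨GeneralLinearGroup.mkOfDetNeZero !![p.1.1, 0; 0, p.1.2] (by
        simp [p.2.1, p.2.2]), Or.inl (by simp [GeneralLinearGroup.mkOfDetNeZero])⟩
    | (false, p) => ⟨GeneralLinearGroup.mkOfDetNeZero !![0, p.1.1; p.1.2, 0] (by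
        simp [p.2.1, p.2.2]), Or.inr (by simp [GeneralLinearGroup.mkOfDetNeZero])⟩
  left_inv h := by
    refine Subtype.ext ?_
    by_cases hd : h.1.val 0 1 = 0 ∧ h.1.val 1 0 = 0
    · ext i j
      fin_cases i <;> fin_cases j <;> simp [GeneralLinearGroup.mkOfDetNeZero, hd]
    · have h1 := h.2.resolve_left hd
      ext i j
      fin_cases i <;> fin_cases j <;> simp [GeneralLinearGroup.mkOfDetNeZero, hd, h1]
  right_inv p := by
    rcases p with ⟨_ | _, ⟨a, b⟩, ha, hb⟩
    · have ha' : a ≠ 0 := ha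
      simp [GeneralLinearGroup.mkOfDetNeZero, ha']
    · simp [GeneralLinearGroup.mkOfDetNeZero]

theorem card_splitCartanNormalizer : Nat.card splitCartanNormalizer = 288 := by
  rw [Nat.card_congr splitCartanNormalizerEquiv, Nat.card_eq_fintype_card]
  decide +kernel

theorem classCount_splitCartanNormalizer {t d : ZMod 13} (hd : d ≠ 0) :
    classCount splitCartanNormalizer t d =
      Fintype.card {a : ZMod 13 // a * (t - a) = d ∧ a ≠ t - a} + if t = 0 then 12 else 0 := by
  have e : {h : GL2F13 // h ∈ splitCartanNormalizer ∧ h ∉ Subgroup.center GL2F13 ∧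
        h.val.trace = t ∧ h.val.det = d} ≃
      {a : ZMod 13 // a * (t - a) = d ∧ a ≠ t - a} ⊕ {b : ZMod 13 // t = 0 ∧ b ≠ 0} :=
    { toFun := fun h => if hh : h.1.val 0 1 = 0 ∧ h.1.val 1 0 = 0
        then Sum.inl ⟨h.1.val 0 0, by
          obtain ⟨h, h1, h3, rfl, rfl⟩ := h
          rw [mem_center_iff_entries] at h3
          have h2 : h.val 1 0 = 0 := hh.2
          simp only [Matrix.trace_fin_two, Matrix.det_fin_two, h2, add_sub_cancel_left]
          exact ⟨by ring, fun h4 => h3 ⟨hh.1, hh.2, h4⟩⟩⟩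
        else Sum.inr ⟨h.1.val 0 1, by
          obtain ⟨h, h1, h3, rfl, rfl⟩ := h
          have h1 := h1.resolve_left hh
          rw [Matrix.det_fin_two, h1.1, zero_mul, zero_sub] at hd
          exact ⟨by simp [Matrix.trace_fin_two, h1],
            (mul_ne_zero_iff.1 (neg_ne_zero.1 hd)).1⟩⟩
      invFun := fun p => match p with
        | Sum.inl a => ⟨GeneralLinearGroup.mkOfDetNeZero !![a.1, 0; 0, t - a.1] (by
            simp [a.2.1, hd]), Or.inl (by simp [GeneralLinearGroup.mkOfDetNeZero]), by
              have := a.2.2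
              simp [mem_center_iff_entries, GeneralLinearGroup.mkOfDetNeZero,
                Matrix.trace_fin_two, a.2.1, this]⟩
        | Sum.inr b => ⟨GeneralLinearGroup.mkOfDetNeZero !![0, b.1; -d / b.1, 0] (by
            simp [hd, b.2.2]),
            Or.inr (by simp [GeneralLinearGroup.mkOfDetNeZero]), by
              have := b.2.2
              simp [mem_center_iff_entries, GeneralLinearGroup.mkOfDetNeZero,
                Matrix.trace_fin_two, this, b.2.1, mul_div_cancel₀]⟩
      left_inv := by
        rintro ⟨h, h1, h3, rfl, rfl⟩
        refine Subtype.ext ?_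
        by_cases hh : h.val 0 1 = 0 ∧ h.val 1 0 = 0
        · ext i j
          fin_cases i <;> fin_cases j <;>
            simp [GeneralLinearGroup.mkOfDetNeZero, hh, Matrix.trace_fin_two]
        · have h1 := h1.resolve_left hh
          have hb : h.val 0 1 ≠ 0 := by
            rw [Matrix.det_fin_two, h1.1, zero_mul, zero_sub] at hd
            exact (mul_ne_zero_iff.1 (neg_ne_zero.1 hd)).1
          ext i j
          fin_cases i <;> fin_cases j <;>
            simp [GeneralLinearGroup.mkOfDetNeZero, h1, Matrix.det_fin_two, hb]
      right_inv := by
        rintro (⟨a, ha⟩ | ⟨b, rfl, hb⟩)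
        · simp [GeneralLinearGroup.mkOfDetNeZero]
        · simp [GeneralLinearGroup.mkOfDetNeZero, hb] }
  rw [classCount, Nat.card_congr e, Nat.card_sum, Nat.card_eq_fintype_card]
  congr 1
  split_ifs with ht
  · rw [Nat.card_congr (Equiv.subtypeEquivRight (q := (· ≠ 0)) fun b => and_iff_right ht),
      Nat.card_eq_fintype_card]
    rfl
  · simp [ht]

end SplitCartan

section Octahedral

theorem card_center : Nat.card (Subgroup.center GL2F13) = 12 := by
  have hi : Function.Injective
      (GeneralLinearGroup.scalar (R := ZMod 13) (Fin 2)) := fun a b hab =>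
    Units.ext congr(($hab).val 0 0)
  rw [GeneralLinearGroup.center_eq_range_scalar,
    ← Nat.card_congr (MonoidHom.ofInjective hi).toEquiv,
    Nat.card_eq_fintype_card, ZMod.card_units]

theorem card_comap_projGL (K : Subgroup PGL2F13) :
    Nat.card (Subgroup.comap projGL K) = 12 * Nat.card K := by
  rw [← card_center, ← Nat.card_prod]
  exact Nat.card_congr (QuotientGroup.preimageMkEquivSubgroupProdSet _ (K : Set PGL2F13))

theorem projGL_eq_one_iff {g : GL2F13} : projGL g = 1 ↔ g ∈ Subgroup.center GL2F13 :=
  QuotientGroup.eq_one_iff g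

theorem exists_smul_of_projGL_eq {g h : GL2F13} (hgh : projGL g = projGL h) :
    ∃ r : ZMod 13, r ≠ 0 ∧ g.val = r • h.val := by
  have hz : g * h⁻¹ ∈ Subgroup.center GL2F13 := by
    rw [← projGL_eq_one_iff, map_mul, map_inv, hgh, mul_inv_cancel]
  rw [GeneralLinearGroup.center_eq_range_scalar] at hz
  obtain ⟨r, hr⟩ := hz
  refine ⟨r, r.ne_zero, ?_⟩
  rw [mul_inv_eq_iff_eq_mul.1 hr.symm]
  ext i j
  simp

theorem trace_sq_eq_det_of_pow_three {h : GL2F13} (hh : h ∉ Subgroup.center GL2F13)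
    (h3 : h ^ 3 ∈ Subgroup.center GL2F13) : h.val.trace ^ 2 = h.val.det := by
  by_contra hne
  apply hh
  rw [mem_center_iff_entries] at h3 ⊢
  simp only [pow_succ, pow_zero, one_mul, Units.val_mul, Matrix.mul_apply,
    Fin.sum_univ_two] at h3
  rw [Matrix.trace_fin_two, Matrix.det_fin_two, ← ne_eq, ← sub_ne_zero] at hne
  refine ⟨mul_left_cancel₀ hne ?_, mul_left_cancel₀ hne ?_, mul_left_cancel₀ hne ?_⟩
  · linear_combination h3.1
  · linear_combination h3.2.1
  · linear_combination h3.2.2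

theorem trace_eq_zero_of_pow_two {h : GL2F13} (hh : h ∉ Subgroup.center GL2F13)
    (h2 : h ^ 2 ∈ Subgroup.center GL2F13) : h.val.trace = 0 := by
  by_contra hne
  apply hh
  rw [mem_center_iff_entries] at h2 ⊢
  simp only [pow_succ, pow_zero, one_mul, Units.val_mul, Matrix.mul_apply,
    Fin.sum_univ_two] at h2
  rw [Matrix.trace_fin_two] at hne
  refine ⟨mul_left_cancel₀ hne ?_, mul_left_cancel₀ hne ?_, mul_left_cancel₀ hne ?_⟩
  · linear_combination h2.1
  · linear_combination h2.2.1
  · linear_combination h2.2.2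

theorem trace_sq_eq_two_mul_det_of_pow_four {h : GL2F13}
    (hh : h ^ 2 ∉ Subgroup.center GL2F13)
    (h4 : h ^ 4 ∈ Subgroup.center GL2F13) : h.val.trace ^ 2 = 2 * h.val.det := by
  have h0 := trace_eq_zero_of_pow_two hh (by rwa [← pow_mul])
  have ht : h.val.trace ≠ 0 := by
    intro ht
    apply hh
    rw [mem_center_iff_entries]
    rw [Matrix.trace_fin_two] at ht
    simp only [pow_succ, pow_zero, one_mul, Units.val_mul, Matrix.mul_apply,
      Fin.sum_univ_two]
    refine ⟨?_, ?_, ?_⟩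
    · linear_combination h.val 0 1 * ht
    · linear_combination h.val 1 0 * ht
    · linear_combination (h.val 0 0 - h.val 1 1) * ht
  simp only [pow_succ, pow_zero, one_mul, Units.val_mul, Matrix.mul_apply,
    Fin.sum_univ_two, Matrix.trace_fin_two, Matrix.det_fin_two] at h0 ⊢
  linear_combination h0

/-- The lifts with trace `t` and determinant `d` of an element of `PGL₂(F₁₃)` correspond to the
scalars with which a given lift has to be multiplied. -/
theorem card_lifts (h₀ : GL2F13) (hh : h₀ ∉ Subgroup.center GL2F13) {t d : ZMod 13} (hd : d ≠ 0) :
    Nat.card {h : GL2F13 // projGL h = projGL h₀ ∧ h ∉ Subgroup.center GL2F13 ∧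
      h.val.trace = t ∧ h.val.det = d} =
    Fintype.card {r : ZMod 13 // r * h₀.val.trace = t ∧ r ^ 2 * h₀.val.det = d} := by
  rw [← Nat.card_eq_fintype_card]
  symm
  refine Nat.card_congr (Equiv.ofBijective (fun r =>
    ⟨GeneralLinearGroup.mkOfDetNeZero (r.1 • h₀.val) (by simpa [Matrix.det_smul, r.2.2]),
      projGL_eq_of_smul r.1 rfl, ?_, ?_, ?_⟩) ⟨?_, ?_⟩)
  · rw [← projGL_eq_one_iff, projGL_eq_of_smul (h := h₀) r.1 rfl, projGL_eq_one_iff]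
    exact hh
  · simpa [GeneralLinearGroup.mkOfDetNeZero] using r.2.1
  · simpa [GeneralLinearGroup.mkOfDetNeZero, Matrix.det_smul] using r.2.2
  · rintro ⟨r, hr⟩ ⟨s, hs⟩ hrs
    have h0 : h₀.val ≠ 0 := fun h0 => h₀.det_ne_zero (by simp [h0])
    exact Subtype.ext (smul_left_injective _ h0 congr(($hrs).1.val))
  · rintro ⟨h, h1, h2, rfl, rfl⟩
    obtain ⟨r, -, hr⟩ := exists_smul_of_projGL_eq h1
    exact ⟨⟨r, by simp [hr], by simp [hr]⟩,
      Subtype.ext (Units.ext hr.symm)⟩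

theorem classCount_comap (K : Subgroup PGL2F13) (t d : ZMod 13) :
    classCount (Subgroup.comap projGL K) t d = ∑ᶠ k : K,
      Nat.card {h : GL2F13 // projGL h = k ∧ h ∉ Subgroup.center GL2F13 ∧
        h.val.trace = t ∧ h.val.det = d} := by
  have := Fintype.ofFinite K
  rw [finsum_eq_sum_of_fintype, ← Nat.card_sigma, classCount]
  exact Nat.card_congr ⟨fun h => ⟨⟨projGL h.1, h.2.1⟩, h.1, rfl, h.2.2⟩,
    fun p => ⟨p.2.1, by rw [Subgroup.mem_comap, p.2.2.1]; exact p.1.2, p.2.2.2⟩,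
    fun h => rfl, fun ⟨⟨k, hk⟩, h, (h1 : _ = k), h2⟩ => by subst h1; rfl⟩

/-- The number of lifts to `GL₂(F₁₃)` with trace `t` and determinant `d` of the element of an
octahedral subgroup of `PGL₂(F₁₃)` that corresponds to `σ`. -/
def octahedralLifts (t d : ZMod 13) (σ : Equiv.Perm (Fin 4)) : ℕ :=
  if σ = 1 then 0
  else if σ ^ 3 = 1 then (if t ^ 2 = d then 1 else 0)
  else if σ ^ 2 = 1 then
    (if ∃ ρ : Equiv.Perm (Fin 4), σ = ρ ^ 2 then (if t = 0 ∧ ∃ x, d = x ^ 2 then 2 else 0)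
    else (if t = 0 ∧ ¬ ∃ x, d = x ^ 2 then 2 else 0))
  else (if t ^ 2 = 2 * d then 1 else 0)

theorem sum_octahedralLifts (t d : ZMod 13) : ∑ σ, octahedralLifts t d σ =
    8 * (if t ^ 2 = d then 1 else 0) + 3 * (if t = 0 ∧ ∃ x, d = x ^ 2 then 2 else 0) +
      6 * (if t = 0 ∧ ¬ ∃ x, d = x ^ 2 then 2 else 0) + 6 * (if t ^ 2 = 2 * d then 1 else 0) := by
  unfold octahedralLifts
  generalize (if t ^ 2 = d then 1 else 0) = a
  generalize (if t = 0 ∧ ∃ x, d = x ^ 2 then 2 else 0) = b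
  generalize (if t = 0 ∧ ¬ ∃ x, d = x ^ 2 then 2 else 0) = c
  generalize (if t ^ 2 = 2 * d then 1 else 0) = e
  simp only [Finset.sum_ite, Finset.sum_const, smul_eq_mul, Finset.filter_filter, mul_zero,
    zero_add]
  rw [← add_assoc, ← add_assoc]
  congr 1

theorem exists_eq_mul_sq_of_not_isSquare : ∀ σ : Equiv.Perm (Fin 4), σ ≠ 1 → σ ^ 2 = 1 →
    (¬ ∃ ρ : Equiv.Perm (Fin 4), σ = ρ ^ 2) →
    ∃ ρ τ : Equiv.Perm (Fin 4), σ = ρ * τ ^ 2 ∧ ρ ^ 2 ≠ 1 ∧ ρ ^ 4 = 1 := by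
  decide +kernel

theorem classCount_octahedral {K : Subgroup PGL2F13} (φ : K ≃* Equiv.Perm (Fin 4))
    {t d : ZMod 13} (hd : d ≠ 0) :
    classCount (Subgroup.comap projGL K) t d = ∑ σ, octahedralLifts t d σ := by
  rw [classCount_comap, ← finsum_comp_equiv φ.symm.toEquiv, finsum_eq_sum_of_fintype]
  have hlift (σ : Equiv.Perm (Fin 4)) : ∃ h : GL2F13, projGL h = φ.symm σ :=
    QuotientGroup.mk'_surjective _ _
  choose L hL using hlift
  have hpow (σ : Equiv.Perm (Fin 4)) (n : ℕ) :
      L σ ^ n ∈ Subgroup.center GL2F13 ↔ σ ^ n = 1 := by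
    rw [← projGL_eq_one_iff, map_pow, hL, ← Subgroup.coe_pow, ← map_pow, OneMemClass.coe_eq_one,
      EmbeddingLike.map_eq_one_iff]
  have hone (σ : Equiv.Perm (Fin 4)) : L σ ∈ Subgroup.center GL2F13 ↔ σ = 1 := by
    simpa using hpow σ 1
  have hsq (ρ : Equiv.Perm (Fin 4)) : ∃ r : ZMod 13, r ≠ 0 ∧
      (L (ρ ^ 2)).val.det = r ^ 2 := by
    have : projGL (L (ρ ^ 2)) = projGL (L ρ ^ 2) := by simp [hL]
    obtain ⟨r, hr, h⟩ := exists_smul_of_projGL_eq this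
    refine ⟨r * (L ρ).val.det, mul_ne_zero hr (L ρ).det_ne_zero, ?_⟩
    simp [h, mul_pow]
  refine Finset.sum_congr rfl fun σ _ => ?_
  by_cases h1 : σ = 1
  · have : IsEmpty {h : GL2F13 // projGL h = φ.symm σ ∧ h ∉ Subgroup.center GL2F13 ∧
        h.val.trace = t ∧ h.val.det = d} := by
      refine ⟨fun ⟨h, hp, hc, _⟩ => hc (projGL_eq_one_iff.1 ?_)⟩
      rw [hp, h1, map_one, Subgroup.coe_one]
    rw [octahedralLifts, if_pos h1]
    exact Nat.card_of_isEmpty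
  have hc : L σ ∉ Subgroup.center GL2F13 := (hone σ).not.2 h1
  have hD := (L σ).det_ne_zero
  refine Eq.trans (by rw [hL]; rfl) ((card_lifts (L σ) hc hd).trans ?_)
  rw [octahedralLifts, if_neg h1]
  by_cases h3 : σ ^ 3 = 1
  · have htr := trace_sq_eq_det_of_pow_three hc ((hpow σ 3).2 h3)
    rw [if_pos h3, ← htr]
    rw [← htr] at hD
    generalize (L σ).val.trace = a at hD
    revert a t d
    decide +kernel
  rw [if_neg h3]
  by_cases h2 : σ ^ 2 = 1
  · rw [if_pos h2, trace_eq_zero_of_pow_two hc ((hpow σ 2).2 h2)]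
    by_cases hs : ∃ ρ : Equiv.Perm (Fin 4), σ = ρ ^ 2
    · rw [if_pos hs]
      obtain ⟨ρ, rfl⟩ := hs
      obtain ⟨r, hr, h⟩ := hsq ρ
      rw [h]
      clear h hsq
      revert r t d
      decide +kernel
    · rw [if_neg hs]
      obtain ⟨ρ, τ, rfl, hρ, hρ'⟩ := exists_eq_mul_sq_of_not_isSquare σ h1 h2 hs
      obtain ⟨e, h⟩ : ∃ e : ZMod 13, (L (ρ * τ ^ 2)).val.det = 7 * e ^ 2 := by
        have : projGL (L (ρ * τ ^ 2)) = projGL (L ρ * L (τ ^ 2)) := by simp [hL]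
        obtain ⟨r, -, h⟩ := exists_smul_of_projGL_eq this
        obtain ⟨s, -, h'⟩ := hsq τ
        have h'' := trace_sq_eq_two_mul_det_of_pow_four ((hpow ρ 2).not.2 hρ) ((hpow ρ 4).2 hρ')
        refine ⟨r * (L ρ).val.trace * s, ?_⟩
        rw [h, Matrix.det_smul, Units.val_mul, Matrix.det_mul, h', mul_pow, mul_pow, h'']
        have h14 : (14 : ZMod 13) = 1 := rfl
        rw [Fintype.card_fin]
        linear_combination (-r ^ 2 * (L ρ).val.det * s ^ 2) * h14
      rw [h] at hD ⊢
      clear h hsq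
      revert e t d
      decide +kernel
  · have h4 : ∀ σ : Equiv.Perm (Fin 4), ¬σ ^ 3 = 1 → ¬σ ^ 2 = 1 → σ ^ 4 = 1 := by
      decide +kernel
    have htr := trace_sq_eq_two_mul_det_of_pow_four ((hpow σ 2).not.2 h2)
      ((hpow σ 4).2 (h4 σ h3 h2))
    have htr : (L σ).val.det = 7 * (L σ).val.trace ^ 2 := by
      rw [htr, ← mul_assoc]
      exact (one_mul _).symm
    rw [if_neg h2, htr]
    rw [htr] at hD
    generalize (L σ).val.trace = a at hD
    revert a t d
    decide +kernel

end Octahedral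

section PermutationCharacters

theorem card_conj_of_mem_center {H : Subgroup GL2F13} (hH : Subgroup.center GL2F13 ≤ H)
    {g : GL2F13} (hg : g ∈ Subgroup.center GL2F13) :
    Nat.card {h : GL2F13 // h ∈ H ∧ IsConj g h} = 1 := by
  rw [Nat.card_eq_one_iff_exists]
  exact ⟨⟨g, hH hg, IsConj.refl g⟩,
    fun h => Subtype.ext ((isConj_iff_eq_of_mem_center hg h.1).1 h.2.2)⟩

theorem card_conj_of_notMem_center (H : Subgroup GL2F13) {g : GL2F13}
    (hg : g ∉ Subgroup.center GL2F13) :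
    Nat.card {h : GL2F13 // h ∈ H ∧ IsConj g h} = classCount H g.val.trace g.val.det := by
  simp only [isConj_iff_trace_det hg, classCount]

theorem center_le_comap_projGL (K : Subgroup PGL2F13) :
    Subgroup.center GL2F13 ≤ Subgroup.comap projGL K := fun g hg => by
  rw [Subgroup.mem_comap, projGL_eq_one_iff.2 hg]
  exact K.one_mem

theorem classCount_identity : ∀ t d : ZMod 13, d ≠ 0 →
    26 * (Fintype.card {a : ZMod 13 // a * (t - a) = d ∧ a ≠ t - a} + if t = 0 then 12 else 0) +
      8 * (∑ a : ZMod 13, if a * (t - a) = d ∧ a ^ 3 = (t - a) ^ 3 then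
        (if a = t - a then 12 else 13) else 0) +
      6 * (∑ a : ZMod 13, if a * (t - a) = d ∧ a ^ 4 = (t - a) ^ 4 then
        (if a = t - a then 12 else 13) else 0) =
    26 * (8 * (if t ^ 2 = d then 1 else 0) + 3 * (if t = 0 ∧ ∃ x, d = x ^ 2 then 2 else 0) +
      6 * (if t = 0 ∧ ¬ ∃ x, d = x ^ 2 then 2 else 0) + 6 * (if t ^ 2 = 2 * d then 1 else 0)) +
      12 * (∑ a : ZMod 13, if a * (t - a) = d ∧ a ^ 2 = (t - a) ^ 2 then
        (if a = t - a then 12 else 13) else 0) +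
      2 * (∑ a : ZMod 13, if a * (t - a) = d ∧ a ^ 12 = (t - a) ^ 12 then
        (if a = t - a then 12 else 13) else 0) := by
  decide +kernel

theorem card_fixed_identity {K1 : Subgroup PGL2F13} (φ : K1 ≃* Equiv.Perm (Fin 4)) (g : GL2F13) :
    2 * Nat.card {x : GL2F13 ⧸ splitCartanNormalizer // g • x = x} +
      Nat.card {x : GL2F13 ⧸ Subgroup.comap projGL K3 // g • x = x} +
      Nat.card {x : GL2F13 ⧸ Subgroup.comap projGL K4 // g • x = x} =
    2 * Nat.card {x : GL2F13 ⧸ Subgroup.comap projGL K1 // g • x = x} +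
      Nat.card {x : GL2F13 ⧸ Subgroup.comap projGL K2 // g • x = x} +
      Nat.card {x : GL2F13 ⧸ borelSubgroup // g • x = x} := by
  have hN := card_fixed_quotient splitCartanNormalizer g
  have h3 := card_fixed_quotient (Subgroup.comap projGL K3) g
  have h4 := card_fixed_quotient (Subgroup.comap projGL K4) g
  have h1 := card_fixed_quotient (Subgroup.comap projGL K1) g
  have h2 := card_fixed_quotient (Subgroup.comap projGL K2) g
  have hB := card_fixed_quotient borelSubgroup g
  have c1 : Nat.card (Subgroup.comap projGL K1) = 288 := by
    rw [card_comap_projGL, Nat.card_congr φ.toEquiv, Nat.card_perm, Nat.card_fin]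
    rfl
  have c2 : Nat.card (upperSubgroup 2) = 312 := by
    rw [card_upperSubgroup]
    decide +kernel
  have c3 : Nat.card (upperSubgroup 3) = 468 := by
    rw [card_upperSubgroup]
    decide +kernel
  have c4 : Nat.card (upperSubgroup 4) = 624 := by
    rw [card_upperSubgroup]
    decide +kernel
  have cB : Nat.card (upperSubgroup 12) = 1872 := by
    rw [card_upperSubgroup]
    decide +kernel
  rw [c1] at h1
  rw [card_splitCartanNormalizer] at hN
  rw [comap_K2] at h2 ⊢
  rw [comap_K3] at h3 ⊢
  rw [comap_K4] at h4 ⊢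
  rw [borelSubgroup_eq] at hB ⊢
  rw [c2] at h2
  rw [c3] at h3
  rw [c4] at h4
  rw [cB] at hB
  by_cases hg : g ∈ Subgroup.center GL2F13
  · rw [card_conj_of_mem_center center_le_splitCartanNormalizer hg] at hN
    rw [card_conj_of_mem_center (center_le_comap_projGL K1) hg] at h1
    rw [card_conj_of_mem_center (center_le_upperSubgroup _) hg] at h2 h3 h4 hB
    lia
  · have hd : g.val.det ≠ 0 := g.det_ne_zero
    rw [card_conj_of_notMem_center _ hg] at hN h1 h2 h3 h4 hB
    have key := classCount_identity g.val.trace g.val.det hd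
    rw [← sum_octahedralLifts, ← classCount_octahedral φ hd, ← classCount_splitCartanNormalizer hd,
      ← classCount_upperSubgroup 2 hd, ← classCount_upperSubgroup 3 hd,
      ← classCount_upperSubgroup 4 hd, ← classCount_upperSubgroup 12 hd] at key
    generalize Nat.card {a : GL2F13 // a⁻¹ * g * a = g} = z at *
    have key' := congrArg (· * z) key
    simp only [add_mul, mul_assoc] at key'
    rw [← hN, ← h1, ← h2, ← h3, ← h4, ← hB] at key'
    lia

/-- The permutation representation of `G` on `ℚ[G/H]`. -/
noncomputable def permRep (H : Subgroup GL2F13) : Representation ℚ GL2F13 (permModule H) where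
  toFun g := Finsupp.lmapDomain ℚ ℚ (g • · : GL2F13 ⧸ H → GL2F13 ⧸ H)
  map_one' := LinearMap.ext fun v => one_smul GL2F13 v
  map_mul' g h := LinearMap.ext fun v => mul_smul g h v

theorem permRep_character (H : Subgroup GL2F13) (g : GL2F13) :
    (permRep H).character g = Nat.card {x : GL2F13 ⧸ H // g • x = x} :=
  trace_lmapDomain_smul g

end PermutationCharacters

/-- There is an isomorphism of `ℚ`-linear permutation representations of `G = GL₂(F₁₃)`:
`ℚ[G/N] ⊕ ℚ[G/N] ⊕ ℚ[G/π⁻¹(K₃)] ⊕ ℚ[G/π⁻¹(K₄)] ≅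
  ℚ[G/π⁻¹(K₁)] ⊕ ℚ[G/π⁻¹(K₁)] ⊕ ℚ[G/π⁻¹(K₂)] ⊕ ℚ[G/B]`,
where `N` is the normaliser of the split Cartan subgroup, `B` is the Borel subgroup,
`K₂ = ⟨u, t⁶⟩`, `K₃ = ⟨u, t⁴⟩`, `K₄ = ⟨u, t³⟩` with `u, t` the images in `PGL₂(F₁₃)` of
`[[1,1],[0,1]]` and `[[2,0],[0,1]]`, and `K₁` is any subgroup of `PGL₂(F₁₃)` isomorphic
to `S₄`. -/
theorem permModule_iso (K1 : Subgroup PGL2F13) (hK1 : Nonempty (K1 ≃* Equiv.Perm (Fin 4))) :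
    ∃ e : (permModule splitCartanNormalizer × permModule splitCartanNormalizer ×
            permModule (Subgroup.comap projGL K3) × permModule (Subgroup.comap projGL K4)) ≃ₗ[ℚ]
          (permModule (Subgroup.comap projGL K1) × permModule (Subgroup.comap projGL K1) ×
            permModule (Subgroup.comap projGL K2) × permModule borelSubgroup),
      ∀ (g : GL2F13) (v : permModule splitCartanNormalizer × permModule splitCartanNormalizer ×
            permModule (Subgroup.comap projGL K3) × permModule (Subgroup.comap projGL K4)),
        e (g • v) = g • e v := by
  obtain ⟨φ⟩ := hK1
  have hchar : ((permRep splitCartanNormalizer).prod ((permRep splitCartanNormalizer).prod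
      ((permRep (Subgroup.comap projGL K3)).prod
        (permRep (Subgroup.comap projGL K4))))).character =
      ((permRep (Subgroup.comap projGL K1)).prod ((permRep (Subgroup.comap projGL K1)).prod
      ((permRep (Subgroup.comap projGL K2)).prod (permRep borelSubgroup)))).character := by
    ext g
    simp only [Representation.char_prod, Pi.add_apply, permRep_character]
    have := card_fixed_identity φ g
    norm_cast
    lia
  obtain ⟨e⟩ := Representation.nonempty_equiv_of_character_eq hchar
  exact ⟨e.toLinearEquiv, fun g v => e.toIntertwiningMap.isIntertwining _ _ g v⟩
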